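/- arXiv:1810.01065 — 2 statements merged into one kernel-verified Lean document; each statement's English description precedes it below -/
import Mathlib

section
/- Let P ⊂ ℝ^n be a full-dimensional polytope all of whose vertices have rational coordinates, i.e. P is the convex hull of a finite set of points of ℚ^n whose affine span is all of ℝ^n. For a positive integer t let L(P,t) = #(tP ∩ ℤ^n), where tP = {tx : x ∈ P}. Then L(P,·) is a quasipolynomial of degree n whose leading coefficient is the volume of P: there exist a positive integer N and polynomials p_0, …, p_{N−1} ∈ ℝ[T], each of degree n with leading coefficient equal to the Lebesgue measure vol(P), such that L(P,t) = p_{t mod N}(t) for every positive integer t. -/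
open MeasureTheory Pointwise

/-- The algebra of real functions on an abelian group generated by the integral linear forms, the
indicators of the half-spaces they define, and the functions that are periodic modulo some positive
integer. -/
def piecewiseQuasiPoly (M : Type*) [AddCommGroup M] : Subalgebra ℝ (M → ℝ) :=
  Algebra.adjoin ℝ
    ({f | ∃ l : M →+ ℤ, f = fun x => (l x : ℝ)} ∪
      {f | ∃ l : M →+ ℤ, f = fun x => if 0 ≤ l x then 1 else 0} ∪
      {f | ∃ N : ℕ, 0 < N ∧ ∀ x z, f (x + N • z) = f x})

namespace piecewiseQuasiPoly

variable {M M' : Type*} [AddCommGroup M] [AddCommGroup M']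

theorem linear_mem (l : M →+ ℤ) : (fun x => (l x : ℝ)) ∈ piecewiseQuasiPoly M :=
  Algebra.subset_adjoin (Or.inl (Or.inl ⟨l, rfl⟩))

theorem indicator_mem (l : M →+ ℤ) :
    (fun x => if 0 ≤ l x then (1 : ℝ) else 0) ∈ piecewiseQuasiPoly M :=
  Algebra.subset_adjoin (Or.inl (Or.inr ⟨l, rfl⟩))

theorem periodic_mem {f : M → ℝ} {N : ℕ} (hN : 0 < N) (hf : ∀ x z, f (x + N • z) = f x) :
    f ∈ piecewiseQuasiPoly M :=
  Algebra.subset_adjoin (Or.inr ⟨N, hN, hf⟩)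

theorem const_mem (c : ℝ) : (fun _ => c) ∈ piecewiseQuasiPoly M :=
  (piecewiseQuasiPoly M).algebraMap_mem c

theorem add_mem' {f g : M → ℝ} (hf : f ∈ piecewiseQuasiPoly M) (hg : g ∈ piecewiseQuasiPoly M) :
    (fun x => f x + g x) ∈ piecewiseQuasiPoly M :=
  add_mem hf hg

theorem sub_mem' {f g : M → ℝ} (hf : f ∈ piecewiseQuasiPoly M) (hg : g ∈ piecewiseQuasiPoly M) :
    (fun x => f x - g x) ∈ piecewiseQuasiPoly M :=
  sub_mem hf hg

theorem mul_mem' {f g : M → ℝ} (hf : f ∈ piecewiseQuasiPoly M) (hg : g ∈ piecewiseQuasiPoly M) :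
    (fun x => f x * g x) ∈ piecewiseQuasiPoly M :=
  mul_mem hf hg

theorem sum_mem' {ι : Type*} (s : Finset ι) {f : ι → M → ℝ}
    (hf : ∀ i ∈ s, f i ∈ piecewiseQuasiPoly M) :
    (fun x => ∑ i ∈ s, f i x) ∈ piecewiseQuasiPoly M := by
  have := sum_mem hf
  convert this using 1
  ext x
  simp

theorem prod_mem' {ι : Type*} (s : Finset ι) {f : ι → M → ℝ}
    (hf : ∀ i ∈ s, f i ∈ piecewiseQuasiPoly M) :
    (fun x => ∏ i ∈ s, f i x) ∈ piecewiseQuasiPoly M := by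
  have := prod_mem hf
  convert this using 1
  ext x
  simp

theorem eval_mem (q : Polynomial ℝ) {f : M → ℝ} (hf : f ∈ piecewiseQuasiPoly M) :
    (fun x => q.eval (f x)) ∈ piecewiseQuasiPoly M := by
  simp only [Polynomial.eval_eq_sum, Polynomial.sum]
  exact sum_mem' _ fun i _ => mul_mem' (const_mem _) (pow_mem hf i)

theorem comp_mem {f : M → ℝ} (hf : f ∈ piecewiseQuasiPoly M) (g : M' →+ M) :
    (fun x => f (g x)) ∈ piecewiseQuasiPoly M' := by
  induction hf using Algebra.adjoin_induction with
  | mem f hf =>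
    rcases hf with (⟨l, rfl⟩ | ⟨l, rfl⟩) | ⟨N, hN, h⟩
    · exact linear_mem (l.comp g)
    · exact indicator_mem (l.comp g)
    · exact periodic_mem hN fun x z => by simp [h]
  | algebraMap r => exact const_mem r
  | add f₁ f₂ _ _ h₁ h₂ => exact add_mem' h₁ h₂
  | mul f₁ f₂ _ _ h₁ h₂ => exact mul_mem' h₁ h₂

/-- On the positive integers, an element of `piecewiseQuasiPoly ℤ` is a quasipolynomial. -/
theorem exists_eval_eq {f : ℤ → ℝ} (hf : f ∈ piecewiseQuasiPoly ℤ) :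
    ∃ N : ℕ, 0 < N ∧ ∃ p : ℕ → Polynomial ℝ, ∀ t : ℕ, 0 < t → f t = (p (t % N)).eval (t : ℝ) := by
  induction hf using Algebra.adjoin_induction with
  | mem f hf =>
    rcases hf with (⟨l, rfl⟩ | ⟨l, rfl⟩) | ⟨N, hN, h⟩
    · refine ⟨1, one_pos, fun _ => Polynomial.C (l 1 : ℝ) * Polynomial.X, fun t _ => ?_⟩
      have : l t = t * l 1 := by rw [← nsmul_eq_mul, ← map_nsmul, nsmul_one]
      simp [this, mul_comm]
    · refine ⟨1, one_pos, fun _ => Polynomial.C (if 0 ≤ l 1 then (1 : ℝ) else 0), fun t ht => ?_⟩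
      rw [Polynomial.eval_C]
      have : l t = t * l 1 := by rw [← nsmul_eq_mul, ← map_nsmul, nsmul_one]
      have ht' : (0 : ℤ) < t := by exact_mod_cast ht
      simp [this, mul_nonneg_iff_of_pos_left ht']
    · refine ⟨N, hN, fun r => Polynomial.C (f r), fun t _ => ?_⟩
      rw [Polynomial.eval_C, ← h ((t % N : ℕ) : ℤ) ((t / N : ℕ) : ℤ)]
      congr 1
      rw [nsmul_eq_mul]
      exact_mod_cast (Nat.mod_add_div t N).symm
  | algebraMap r => exact ⟨1, one_pos, fun _ => Polynomial.C r, fun t _ => by simp⟩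
  | add f₁ f₂ _ _ h₁ h₂ =>
    obtain ⟨N₁, hN₁, p₁, h₁⟩ := h₁
    obtain ⟨N₂, hN₂, p₂, h₂⟩ := h₂
    refine ⟨N₁ * N₂, by positivity, fun r => p₁ (r % N₁) + p₂ (r % N₂), fun t ht => ?_⟩
    simp [h₁ t ht, h₂ t ht]
  | mul f₁ f₂ _ _ h₁ h₂ =>
    obtain ⟨N₁, hN₁, p₁, h₁⟩ := h₁
    obtain ⟨N₂, hN₂, p₂, h₂⟩ := h₂
    refine ⟨N₁ * N₂, by positivity, fun r => p₁ (r % N₁) * p₂ (r % N₂), fun t ht => ?_⟩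
    simp [h₁ t ht, h₂ t ht]

end piecewiseQuasiPoly

/-- An integer-valued function in `piecewiseQuasiPoly M` whose residue modulo every positive integer
is periodic. -/
def IsIntegralQuasiPoly {M : Type*} [AddCommGroup M] (φ : M → ℤ) : Prop :=
  (fun x => (φ x : ℝ)) ∈ piecewiseQuasiPoly M ∧
    ∀ D : ℤ, 0 < D → ∃ N : ℕ, 0 < N ∧ ∀ x z, D ∣ φ (x + N • z) - φ x

namespace IsIntegralQuasiPoly

open piecewiseQuasiPoly

variable {M : Type*} [AddCommGroup M]

theorem of_addMonoidHom (l : M →+ ℤ) : IsIntegralQuasiPoly l := by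
  refine ⟨linear_mem l, fun D hD => ⟨D.toNat, by omega, fun x z => ?_⟩⟩
  simp [Int.toNat_of_nonneg hD.le]

theorem sub_const {φ : M → ℤ} (hφ : IsIntegralQuasiPoly φ) (c : ℤ) :
    IsIntegralQuasiPoly fun x => φ x - c := by
  refine ⟨?_, fun D hD => ?_⟩
  · simpa using sub_mem' hφ.1 (const_mem (c : ℝ))
  · simpa using hφ.2 D hD

theorem ediv {φ : M → ℤ} (hφ : IsIntegralQuasiPoly φ) {d : ℤ} (hd : 0 < d) :
    IsIntegralQuasiPoly fun x => φ x / d := by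
  constructor
  · have hmod : (fun x => ((φ x % d : ℤ) : ℝ)) ∈ piecewiseQuasiPoly M := by
      obtain ⟨N, hN, h⟩ := hφ.2 d hd
      refine periodic_mem hN fun x z => ?_
      have : φ (x + N • z) % d = φ x % d :=
        Int.emod_eq_emod_iff_emod_sub_eq_zero.2 (Int.emod_eq_zero_of_dvd (h x z))
      rw [this]
    convert mul_mem' (const_mem (d : ℝ)⁻¹) (sub_mem' hφ.1 hmod) using 2 with x
    have hd' : (d : ℝ) ≠ 0 := by exact_mod_cast hd.ne'
    have := Int.emod_add_ediv_mul (φ x) d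
    field_simp
    rw [eq_sub_iff_add_eq, add_comm]
    exact_mod_cast this
  · intro D hD
    obtain ⟨N, hN, h⟩ := hφ.2 (D * d) (by positivity)
    refine ⟨N, hN, fun x z => ?_⟩
    obtain ⟨k, hk⟩ := h x z
    have : φ (x + N • z) = φ x + D * k * d := by linarith
    simp only [this, Int.add_mul_ediv_right _ _ hd.ne']
    exact ⟨k, by ring⟩

end IsIntegralQuasiPoly

theorem exists_eval_sub_eval_eq (p : Polynomial ℝ) :
    ∃ q : Polynomial ℝ, ∀ m : ℤ, q.eval (m : ℝ) - q.eval ((m - 1 : ℤ) : ℝ) = p.eval (m : ℝ) := by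
  suffices ∃ q : Polynomial ℝ, ∀ m : ℤ,
      q.eval ((m + 1 : ℤ) : ℝ) - q.eval (m : ℝ) = p.eval (m : ℝ) by
    obtain ⟨q, hq⟩ := this
    refine ⟨q.comp (Polynomial.X + 1), fun m => ?_⟩
    simpa using hq m
  induction p using Polynomial.induction_on' with
  | add p₁ p₂ h₁ h₂ =>
    obtain ⟨q₁, h₁⟩ := h₁
    obtain ⟨q₂, h₂⟩ := h₂
    refine ⟨q₁ + q₂, fun m => ?_⟩
    rw [Polynomial.eval_add, Polynomial.eval_add, Polynomial.eval_add, ← h₁, ← h₂]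
    ring
  | monomial k a =>
    refine ⟨Polynomial.C (a / (k + 1)) *
      (Polynomial.bernoulli (k + 1)).map (algebraMap ℚ ℝ), fun m => ?_⟩
    have h := Polynomial.bernoulli_eval_one_add (k + 1) (m : ℚ)
    have h' : (((Polynomial.bernoulli (k + 1)).eval ((m + 1 : ℤ) : ℚ) : ℚ) : ℝ) =
        ((Polynomial.bernoulli (k + 1)).eval (m : ℚ) : ℚ) + (k + 1) * (m : ℝ) ^ k := by
      rw [Int.cast_add, Int.cast_one, add_comm, h]
      simp
    have hk : (k + 1 : ℝ) ≠ 0 := by positivity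
    rw [Polynomial.eval_mul, Polynomial.eval_mul, Polynomial.eval_intCast_map,
      Polynomial.eval_intCast_map, Polynomial.eval_C, Polynomial.eval_C, Polynomial.eval_monomial]
    rw [eq_ratCast, eq_ratCast, h']
    field_simp
    ring

/-- The greatest integer `y` with `d * y ≤ β x` (for `e = 0`) or `d * y < β x` (for `e = 1`), where
`β` is an integral linear form and `d` is a positive integer. -/
def IsThreshold {M : Type*} [AddCommGroup M] (φ : M → ℤ) : Prop :=
  ∃ (β : M →+ ℤ) (d e : ℤ), 0 < d ∧ (e = 0 ∨ e = 1) ∧ φ = fun x => (β x - e) / d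

namespace IsThreshold

open piecewiseQuasiPoly

variable {M : Type*} [AddCommGroup M]

theorem isIntegralQuasiPoly {φ : M → ℤ} (hφ : IsThreshold φ) : IsIntegralQuasiPoly φ := by
  obtain ⟨β, d, e, hd, -, rfl⟩ := hφ
  exact ((IsIntegralQuasiPoly.of_addMonoidHom β).sub_const e).ediv hd

theorem exists_comparison {φ ψ : M → ℤ} (hφ : IsThreshold φ) (hψ : IsThreshold ψ) :
    ∃ c ∈ piecewiseQuasiPoly M, ∀ x, (c x = 1 ∧ φ x ≤ ψ x) ∨ (c x = 0 ∧ ψ x ≤ φ x) := by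
  obtain ⟨β, d, e, hd, he, rfl⟩ := hφ
  obtain ⟨γ, d', e', hd', he', rfl⟩ := hψ
  have key : ∀ (b c d d' e e' : ℤ), 0 < d → 0 < d' → (e = 0 ∨ e = 1) → (e' = 0 ∨ e' = 1) →
      (d' * b < d * c ∨ d' * b ≤ d * c ∧ e' ≤ e) → (b - e) / d ≤ (c - e') / d' := by
    intro b c d d' e e' hd hd' he he' h
    rw [Int.le_ediv_iff_mul_le hd']
    have h₁ : (b - e) / d * d ≤ b - e := Int.ediv_mul_le _ hd.ne'
    set y := (b - e) / d
    by_contra! hlt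
    rcases he with rfl | rfl <;> rcases he' with rfl | rfl <;> rcases h with h | ⟨h, h'⟩ <;>
      first
      | omega
      | nlinarith
  by_cases hee : e = 0 ∧ e' = 1
  · obtain ⟨rfl, rfl⟩ := hee
    refine ⟨_, sub_mem' (const_mem 1) (indicator_mem (d' • β - d • γ)), fun x => ?_⟩
    by_cases h : 0 ≤ (d' • β - d • γ) x
    · right
      have h' : d * γ x ≤ d' * β x := by simpa using h
      exact ⟨by simp only [if_pos h, sub_self], key _ _ _ _ _ _ hd' hd he' he (by omega)⟩
    · left
      have h' : d' * β x < d * γ x := by simpa using h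
      exact ⟨by simp only [if_neg h, sub_zero], key _ _ _ _ _ _ hd hd' he he' (by omega)⟩
  · refine ⟨_, indicator_mem (d • γ - d' • β), fun x => ?_⟩
    by_cases h : 0 ≤ (d • γ - d' • β) x
    · left
      have h' : d' * β x ≤ d * γ x := by simpa using h
      exact ⟨if_pos h, key _ _ _ _ _ _ hd hd' he he' (by omega)⟩
    · right
      have h' : d * γ x < d' * β x := by simpa using h
      exact ⟨if_neg h, key _ _ _ _ _ _ hd' hd he' he (by omega)⟩

end IsThreshold

/-- A monomial in one integer variable with a periodic coefficient. -/
def IsQuasiMonomial (g : ℤ → ℝ) : Prop :=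
  ∃ (h : ℤ → ℝ) (N k : ℕ), 0 < N ∧ (∀ y z, h (y + N • z) = h y) ∧ g = fun y => h y * (y : ℝ) ^ k

namespace IsQuasiMonomial

theorem mul_id {g : ℤ → ℝ} (hg : IsQuasiMonomial g) : IsQuasiMonomial fun y => g y * y := by
  obtain ⟨h, N, k, hN, hh, rfl⟩ := hg
  exact ⟨h, N, k + 1, hN, hh, by ext; ring⟩

theorem mul_periodic {g : ℤ → ℝ} (hg : IsQuasiMonomial g) {h' : ℤ → ℝ} {N' : ℕ} (hN' : 0 < N')
    (hh' : ∀ y z, h' (y + N' • z) = h' y) : IsQuasiMonomial fun y => g y * h' y := by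
  obtain ⟨h, N, k, hN, hh, rfl⟩ := hg
  refine ⟨fun y => h y * h' y, N * N', k, by positivity, fun y z => ?_, by ext; ring⟩
  dsimp only
  congr 1
  · rw [mul_comm N, mul_nsmul, hh]
  · rw [mul_nsmul, hh']

end IsQuasiMonomial

theorem dvd_indicator_periodic (N : ℕ) (r y z : ℤ) :
    (if (N : ℤ) ∣ y + N • z - r then (1 : ℝ) else 0) = if (N : ℤ) ∣ y - r then 1 else 0 := by
  have : y + N • z - r = y - r + N * z := by simp; ring
  rw [this]
  simp only [dvd_add_left (dvd_mul_right (N : ℤ) z)]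

theorem sum_residue_mul_indicator {N : ℕ} (hN : 0 < N) (h : ℤ → ℝ)
    (hh : ∀ y z, h (y + N • z) = h y) (y : ℤ) :
    ∑ r ∈ Finset.range N, h r * (if (N : ℤ) ∣ y - r then 1 else 0) = h y := by
  have hN' : (0 : ℤ) < N := by exact_mod_cast hN
  have hr : ((y % N).toNat : ℤ) = y % N := Int.toNat_of_nonneg (Int.emod_nonneg _ hN'.ne')
  have hlt := Int.emod_lt_of_pos y hN'
  rw [Finset.sum_eq_single (y % N).toNat]
  · have hy : h y = h (y % N) := by
      conv_lhs => rw [← Int.emod_add_mul_ediv y N, ← nsmul_eq_mul, hh]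
    rw [hr, if_pos (Int.dvd_self_sub_emod), mul_one, hy]
  · intro r hrm hne
    rw [if_neg, mul_zero]
    intro hdvd
    have h₁ : y % N = (r : ℤ) % N := Int.emod_eq_emod_iff_emod_sub_eq_zero.2
      (Int.emod_eq_zero_of_dvd hdvd)
    have h₂ : (r : ℤ) % N = r := Int.emod_eq_of_lt (by omega) (by simpa using hrm)
    omega
  · intro hnm
    exact absurd (Finset.mem_range.2 (by omega)) hnm

theorem sum_Ioc_succ {a b : ℤ} (hab : a ≤ b) (g : ℤ → ℝ) :
    ∑ y ∈ Finset.Ioc a (b + 1), g y = ∑ y ∈ Finset.Ioc a b, g y + g (b + 1) := by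
  have : Finset.Ioc a (b + 1) = insert (b + 1) (Finset.Ioc a b) := by
    ext y
    simp only [Finset.mem_Ioc, Finset.mem_insert]
    omega
  rw [this, Finset.sum_insert (by simp), add_comm]

theorem sum_Ioc_residue {N : ℕ} (hN : 0 < N) (r : ℤ) (k : ℕ) {q : Polynomial ℝ}
    (hq : ∀ m : ℤ, q.eval (m : ℝ) - q.eval ((m - 1 : ℤ) : ℝ) = ((N : ℝ) * m + r) ^ k)
    {a b : ℤ} (hab : a ≤ b) :
    ∑ y ∈ Finset.Ioc a b, (if (N : ℤ) ∣ y - r then (1 : ℝ) else 0) * (y : ℝ) ^ k =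
      q.eval (((b - r) / N : ℤ) : ℝ) - q.eval (((a - r) / N : ℤ) : ℝ) := by
  have hN' : (0 : ℤ) < N := by exact_mod_cast hN
  induction b, hab using Int.leInduction with
  | base => simp
  | succ b hab ih =>
    rw [sum_Ioc_succ hab, ih]
    split_ifs with h
    · obtain ⟨m, hm⟩ := h
      have h₁ : (b + 1 - r) / N = m := by rw [hm, Int.mul_ediv_cancel_left _ hN'.ne']
      have h₂ : (b - r) / N = m - 1 := by
        rw [Int.ediv_eq_iff_of_pos hN']
        constructor <;> linarith
      have h₃ : ((b + 1 : ℤ) : ℝ) = N * m + r := by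
        have : b + 1 = N * m + r := by omega
        rw [this]
        push_cast
        ring
      rw [h₁, h₂, h₃, ← hq]
      ring
    · have h₁ : (b + 1 - r) / N = (b - r) / N := by
        have hle := Int.ediv_mul_le (b - r) hN'.ne'
        have hlt := Int.lt_ediv_add_one_mul_self (b - r) hN'
        rw [Int.ediv_eq_iff_of_pos hN']
        refine ⟨by linarith, lt_of_le_of_ne (by linarith) fun heq => h ?_⟩
        exact ⟨(b - r) / N + 1, by linarith⟩
      rw [h₁]
      ring

open piecewiseQuasiPoly in
theorem sum_Ioc_mem {M : Type*} [AddCommGroup M] {φ ψ : M → ℤ} (hφ : IsThreshold φ)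
    (hψ : IsThreshold ψ) {g : ℤ → ℝ} (hg : IsQuasiMonomial g) :
    (fun x => ∑ y ∈ Finset.Ioc (φ x) (ψ x), g y) ∈ piecewiseQuasiPoly M := by
  obtain ⟨h, N, k, hN, hh, rfl⟩ := hg
  have hN' : (0 : ℤ) < N := by exact_mod_cast hN
  have hsum : (fun x => ∑ y ∈ Finset.Ioc (φ x) (ψ x), h y * (y : ℝ) ^ k) = fun x =>
      ∑ r ∈ Finset.range N, h r * ∑ y ∈ Finset.Ioc (φ x) (ψ x),
        (if (N : ℤ) ∣ y - r then (1 : ℝ) else 0) * (y : ℝ) ^ k := by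
    ext x
    simp_rw [Finset.mul_sum]
    rw [Finset.sum_comm]
    refine Finset.sum_congr rfl fun y _ => ?_
    simp_rw [← mul_assoc]
    rw [← Finset.sum_mul, sum_residue_mul_indicator hN h hh]
  rw [hsum]
  refine sum_mem' _ fun r _ => mul_mem' (const_mem _) ?_
  obtain ⟨q, hq⟩ := exists_eval_sub_eval_eq
    ((Polynomial.C (N : ℝ) * Polynomial.X + Polynomial.C (r : ℝ)) ^ k)
  obtain ⟨c, hc, hcomp⟩ := hφ.exists_comparison hψ
  have hmem : ∀ {θ : M → ℤ}, IsThreshold θ →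
      (fun x => q.eval (((θ x - r) / N : ℤ) : ℝ)) ∈ piecewiseQuasiPoly M := fun hθ =>
    eval_mem q ((hθ.isIntegralQuasiPoly.sub_const r).ediv hN').1
  convert mul_mem' hc (sub_mem' (hmem hψ) (hmem hφ)) using 2 with x
  rcases hcomp x with ⟨h₁, hle⟩ | ⟨h₁, hle⟩
  · rw [h₁, one_mul]
    exact sum_Ioc_residue hN r k (by simpa using hq) hle
  · rw [h₁, zero_mul, Finset.Ioc_eq_empty_of_le hle, Finset.sum_empty]

/-- The sums of `f` over the fibres of `M × ℤ → M`, weighted by a quasi-monomial and taken between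
two thresholds, lie in `piecewiseQuasiPoly M`. -/
def HasQuasiPolySums {M : Type*} [AddCommGroup M] (f : M × ℤ → ℝ) : Prop :=
  ∀ ⦃φ ψ : M → ℤ⦄, IsThreshold φ → IsThreshold ψ → ∀ ⦃g : ℤ → ℝ⦄, IsQuasiMonomial g →
    (fun x => ∑ y ∈ Finset.Ioc (φ x) (ψ x), g y * f (x, y)) ∈ piecewiseQuasiPoly M

namespace HasQuasiPolySums

open piecewiseQuasiPoly

variable {M : Type*} [AddCommGroup M] {f f' : M × ℤ → ℝ}

theorem one : HasQuasiPolySums (fun _ : M × ℤ => 1) := fun φ ψ hφ hψ g hg => by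
  simpa using sum_Ioc_mem hφ hψ hg

theorem add (hf : HasQuasiPolySums f) (hf' : HasQuasiPolySums f') :
    HasQuasiPolySums fun z => f z + f' z := fun φ ψ hφ hψ g hg => by
  simpa only [mul_add, Finset.sum_add_distrib] using add_mem' (hf hφ hψ hg) (hf' hφ hψ hg)

theorem sum {ι : Type*} (s : Finset ι) {F : ι → M × ℤ → ℝ}
    (hF : ∀ i ∈ s, HasQuasiPolySums (F i)) : HasQuasiPolySums fun z => ∑ i ∈ s, F i z :=
  fun φ ψ hφ hψ g hg => by
    simp_rw [Finset.mul_sum]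
    have h : (fun x => ∑ y ∈ Finset.Ioc (φ x) (ψ x), ∑ i ∈ s, g y * F i (x, y)) =
        fun x => ∑ i ∈ s, ∑ y ∈ Finset.Ioc (φ x) (ψ x), g y * F i (x, y) :=
      funext fun x => Finset.sum_comm
    rw [h]
    exact sum_mem' s fun i hi => hF i hi hφ hψ hg

theorem fst_mul {c : M → ℝ} (hc : c ∈ piecewiseQuasiPoly M) (hf : HasQuasiPolySums f) :
    HasQuasiPolySums fun z => c z.1 * f z := fun φ ψ hφ hψ g hg => by
  simpa only [mul_left_comm _ (c _), ← Finset.mul_sum] using mul_mem' hc (hf hφ hψ hg)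

theorem snd_mul (hf : HasQuasiPolySums f) : HasQuasiPolySums fun z => (z.2 : ℝ) * f z :=
  fun φ ψ hφ hψ g hg => by
    simpa only [mul_assoc] using hf hφ hψ hg.mul_id

theorem snd_periodic_mul {h : ℤ → ℝ} {N : ℕ} (hN : 0 < N) (hh : ∀ y z, h (y + N • z) = h y)
    (hf : HasQuasiPolySums f) : HasQuasiPolySums fun z => h z.2 * f z :=
  fun φ ψ hφ hψ g hg => by
    simpa only [mul_assoc] using hf hφ hψ (hg.mul_periodic hN hh)

theorem indicator_le_mul {θ : M → ℤ} (hθ : IsThreshold θ) (hf : HasQuasiPolySums f) :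
    HasQuasiPolySums fun z => (if z.2 ≤ θ z.1 then 1 else 0) * f z := fun φ ψ hφ hψ g hg => by
  obtain ⟨c, hc, hcomp⟩ := hθ.exists_comparison hψ
  convert add_mem' (mul_mem' hc (hf hφ hθ hg))
    (mul_mem' (sub_mem' (const_mem 1) hc) (hf hφ hψ hg)) using 2 with x
  simp only [ite_mul, one_mul, zero_mul, mul_ite, mul_zero]
  rw [← Finset.sum_filter]
  rcases hcomp x with ⟨h, hle⟩ | ⟨h, hle⟩
  · rw [h, sub_self, zero_mul, add_zero, one_mul]
    congr 1
    ext y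
    simp only [Finset.mem_filter, Finset.mem_Ioc]
    omega
  · rw [h, sub_zero, zero_mul, zero_add, one_mul]
    congr 1
    ext y
    simp only [Finset.mem_filter, Finset.mem_Ioc]
    omega

theorem periodic_mul {a : M × ℤ → ℝ} {N : ℕ} (hN : 0 < N) (ha : ∀ z w, a (z + N • w) = a z)
    (hf : HasQuasiPolySums f) : HasQuasiPolySums fun z => a z * f z := by
  have h : (fun z => a z * f z) = fun z => ∑ r ∈ Finset.range N,
      a (z.1, (r : ℤ)) * ((if (N : ℤ) ∣ z.2 - r then 1 else 0) * f z) := by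
    ext ⟨x, y⟩
    have := sum_residue_mul_indicator hN (fun y => a (x, y))
      (fun y w => by simpa using ha (x, y) (0, w)) y
    rw [← this, Finset.sum_mul]
    simp_rw [mul_assoc]
  rw [h]
  refine sum _ fun r _ => fst_mul (c := fun x => a (x, (r : ℤ))) ?_ ?_
  · exact periodic_mem hN fun x w => by simpa using ha (x, r) (w, 0)
  · exact snd_periodic_mul hN (h := fun y => if (N : ℤ) ∣ y - r then 1 else 0)
      (dvd_indicator_periodic N r) hf

theorem linear_apply (l : M × ℤ →+ ℤ) (z : M × ℤ) :
    l z = l.comp (AddMonoidHom.inl M ℤ) z.1 + l (0, 1) * z.2 := by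
  have h : z = (z.1, 0) + z.2 • (0, 1) := by ext <;> simp
  conv_lhs => rw [h, map_add, map_zsmul, smul_eq_mul, mul_comm]
  rfl

theorem linear_mul (l : M × ℤ →+ ℤ) (hf : HasQuasiPolySums f) :
    HasQuasiPolySums fun z => (l z : ℝ) * f z := by
  have h : (fun z => (l z : ℝ) * f z) = fun z =>
      (l.comp (AddMonoidHom.inl M ℤ) z.1 : ℝ) * f z + (l (0, 1) : ℝ) * (z.2 * f z) := by
    ext z
    rw [linear_apply]
    push_cast
    ring
  rw [h]
  exact (hf.fst_mul (linear_mem _)).add (hf.snd_mul.fst_mul (const_mem _))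

theorem indicator_mul (l : M × ℤ →+ ℤ) (hf : HasQuasiPolySums f) :
    HasQuasiPolySums fun z => (if 0 ≤ l z then 1 else 0) * f z := by
  set β := l.comp (AddMonoidHom.inl M ℤ)
  set c := l (0, 1)
  have hl : ∀ z, l z = β z.1 + c * z.2 := linear_apply l
  rcases lt_trichotomy c 0 with hneg | hzero | hpos
  · have hd : 0 < -c := by omega
    have h := hf.indicator_le_mul ⟨β, -c, 0, hd, Or.inl rfl, rfl⟩
    have hiff : ∀ z : M × ℤ, 0 ≤ l z ↔ z.2 ≤ (β z.1 - 0) / -c := fun z => by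
      rw [hl, Int.le_ediv_iff_mul_le hd]
      constructor <;> intro h <;> linarith
    simpa only [hiff] using h
  · simpa only [hl, hzero, zero_mul, add_zero] using hf.fst_mul (indicator_mem β)
  · have h := hf.add ((hf.indicator_le_mul ⟨-β, c, 1, hpos, Or.inr rfl, rfl⟩).fst_mul
      (const_mem (-1)))
    convert h using 2 with z
    have hiff : z.2 ≤ ((-β) z.1 - 1) / c ↔ ¬ 0 ≤ l z := by
      rw [hl, Int.le_ediv_iff_mul_le hpos, AddMonoidHom.neg_apply, mul_comm]
      omega
    by_cases h : 0 ≤ l z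
    · rw [if_pos h, if_neg (by rwa [hiff, not_not])]
      ring
    · rw [if_neg h, if_pos (hiff.2 h)]
      ring

theorem mul {a : M × ℤ → ℝ} (ha : a ∈ piecewiseQuasiPoly (M × ℤ)) (hf : HasQuasiPolySums f) :
    HasQuasiPolySums fun z => a z * f z := by
  induction ha using Algebra.adjoin_induction generalizing f with
  | mem a ha =>
    rcases ha with (⟨l, rfl⟩ | ⟨l, rfl⟩) | ⟨N, hN, h⟩
    · exact hf.linear_mul l
    · exact hf.indicator_mul l
    · exact hf.periodic_mul hN h
  | algebraMap r => exact hf.fst_mul (const_mem r)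
  | add a₁ a₂ _ _ h₁ h₂ => simpa only [Pi.add_apply, add_mul] using (h₁ hf).add (h₂ hf)
  | mul a₁ a₂ _ _ h₁ h₂ => simpa only [Pi.mul_apply, mul_assoc] using h₁ (h₂ hf)

end HasQuasiPolySums

namespace piecewiseQuasiPoly

theorem sum_Icc_mem {M : Type*} [AddCommGroup M] {f : M × ℤ → ℝ}
    (hf : f ∈ piecewiseQuasiPoly (M × ℤ)) (τ : M →+ ℤ) :
    (fun x => ∑ y ∈ Finset.Icc (-τ x) (τ x), f (x, y)) ∈ piecewiseQuasiPoly M := by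
  have h := HasQuasiPolySums.one.mul hf
    (φ := fun x => ((-τ) x - 1) / 1) (ψ := fun x => (τ x - 0) / 1)
    ⟨-τ, 1, 1, one_pos, Or.inr rfl, rfl⟩ ⟨τ, 1, 0, one_pos, Or.inl rfl, rfl⟩ (g := fun _ => 1)
    ⟨fun _ => 1, 1, 0, one_pos, fun _ _ => rfl, by simp⟩
  convert h using 2 with x
  simp only [one_mul, mul_one, Int.ediv_one, sub_zero, AddMonoidHom.neg_apply]
  congr 1
  ext y
  simp only [Finset.mem_Icc, Finset.mem_Ioc]
  omega

theorem sum_piFinset_succ {n : ℕ} (s : Finset ℤ) (F : (Fin (n + 1) → ℤ) → ℝ) :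
    ∑ y ∈ Fintype.piFinset (fun _ => s), F y =
      ∑ y ∈ Fintype.piFinset (fun _ : Fin n => s), ∑ z ∈ s, F (Fin.cons z y) := by
  rw [Finset.sum_sigma']
  refine Finset.sum_bij' (fun y _ => ⟨Fin.tail y, y 0⟩) (fun p _ => Fin.cons p.2 p.1)
    ?_ ?_ ?_ ?_ ?_
  · intro y hy
    simp only [Fintype.mem_piFinset, Finset.mem_sigma] at hy ⊢
    exact ⟨fun i => hy i.succ, hy 0⟩
  · rintro ⟨y, z⟩ h
    simp only [Fintype.mem_piFinset, Finset.mem_sigma] at h ⊢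
    exact Fin.cases h.2 h.1
  · intro y _
    simp
  · rintro ⟨y, z⟩ _
    simp
  · intro y _
    simp

theorem sum_piFinset_Icc_mem {n : ℕ} {M : Type*} [AddCommGroup M] {f : M × (Fin n → ℤ) → ℝ}
    (hf : f ∈ piecewiseQuasiPoly (M × (Fin n → ℤ))) (τ : M →+ ℤ) :
    (fun x => ∑ y ∈ Fintype.piFinset (fun _ => Finset.Icc (-τ x) (τ x)), f (x, y)) ∈
      piecewiseQuasiPoly M := by
  induction n with
  | zero =>
    simp only [Finset.univ_unique, Fintype.piFinset_of_isEmpty, Finset.sum_singleton]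
    convert comp_mem hf (AddMonoidHom.inl M (Fin 0 → ℤ)) using 3
    exact Prod.ext rfl (Subsingleton.elim _ _)
  | succ n ih =>
    simp_rw [sum_piFinset_succ]
    let e : (M × (Fin n → ℤ)) × ℤ →+ M × (Fin (n + 1) → ℤ) :=
      AddMonoidHom.mk' (fun p => (p.1.1, Fin.cons p.2 p.1.2)) fun p q => by
        ext i
        · rfl
        · refine Fin.cases ?_ (fun i => ?_) i <;> simp
    exact ih (sum_Icc_mem (comp_mem hf e) (τ.comp (AddMonoidHom.fst M (Fin n → ℤ))))

end piecewiseQuasiPoly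

/-- The rational linear form `∑ i, a i * x i` on `ι → ℝ`. -/
def ratForm {ι : Type*} [Fintype ι] (a : ι → ℚ) (x : ι → ℝ) : ℝ :=
  ∑ i, (a i : ℝ) * x i

theorem ratForm_add_smul {ι : Type*} [Fintype ι] (a b : ι → ℚ) (p q : ℚ) (x : ι → ℝ) :
    ratForm (p • a + q • b) x = p * ratForm a x + q * ratForm b x := by
  simp only [ratForm, Finset.mul_sum, ← Finset.sum_add_distrib]
  refine Finset.sum_congr rfl fun i _ => ?_
  simp
  ring

theorem ratForm_sub_smul {ι : Type*} [Fintype ι] (a v : ι → ℚ) (s : ℝ) (x : ι → ℝ) :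
    ratForm a (x - s • fun i => (v i : ℝ)) = ratForm a x - s * ((∑ i, a i * v i : ℚ) : ℝ) := by
  simp only [ratForm, Rat.cast_sum, Finset.mul_sum, ← Finset.sum_sub_distrib]
  refine Finset.sum_congr rfl fun i _ => ?_
  simp
  ring

theorem exists_between_finsets {L U : Finset ℝ} (h : ∀ l ∈ L, ∀ u ∈ U, l ≤ u) (hL : L.Nonempty) :
    ∃ s, (∀ l ∈ L, l ≤ s) ∧ ∀ u ∈ U, s ≤ u :=
  ⟨L.max' hL, fun l hl => L.le_max' l hl, fun u hu => h _ (L.max'_mem hL) u hu⟩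

/-- **Fourier–Motzkin elimination**: adding a rational ray to a cone cut out by finitely many
rational half-spaces gives a cone of the same kind. -/
theorem exists_halfspaces_add_ray {ι : Type*} [Fintype ι] (F : Finset (ι → ℚ)) (v : ι → ℚ) :
    ∃ F' : Finset (ι → ℚ), ∀ x : ι → ℝ, (∀ a ∈ F', 0 ≤ ratForm a x) ↔
      ∃ s : ℝ, 0 ≤ s ∧ ∀ a ∈ F, 0 ≤ ratForm a (x - s • fun i => (v i : ℝ)) := by
  classical
  let d : (ι → ℚ) → ℚ := fun a => ∑ i, a i * v i
  have hd : ∀ a x (s : ℝ), ratForm a (x - s • fun i => (v i : ℝ)) = ratForm a x - s * (d a : ℝ) :=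
    fun a x s => ratForm_sub_smul a v s x
  refine ⟨F.filter (fun a => 0 ≤ d a) ∪ Finset.image₂ (fun a b => (-d b) • a + d a • b)
    (F.filter fun a => 0 < d a) (F.filter fun b => d b < 0), fun x => ⟨fun h => ?_, ?_⟩⟩
  · have h₁ : ∀ a ∈ F, 0 ≤ d a → 0 ≤ ratForm a x := fun a ha hda =>
      h a (Finset.mem_union_left _ (Finset.mem_filter.2 ⟨ha, hda⟩))
    have h₂ : ∀ a ∈ F, 0 < d a → ∀ b ∈ F, d b < 0 →
        0 ≤ -(d b : ℝ) * ratForm a x + d a * ratForm b x := fun a ha hda b hb hdb => by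
      have := h _ (Finset.mem_union_right _ (Finset.mem_image₂_of_mem
        (Finset.mem_filter.2 ⟨ha, hda⟩) (Finset.mem_filter.2 ⟨hb, hdb⟩)))
      rw [ratForm_add_smul] at this
      exact_mod_cast this
    obtain ⟨s, hs, hs'⟩ := exists_between_finsets
      (L := insert 0 ((F.filter fun b => d b < 0).image fun b => ratForm b x / d b))
      (U := (F.filter fun a => 0 < d a).image fun a => ratForm a x / d a) (by
        simp only [Finset.mem_insert, Finset.mem_image, Finset.mem_filter]
        rintro l (rfl | ⟨b, ⟨hb, hdb⟩, rfl⟩) u ⟨a, ⟨ha, hda⟩, rfl⟩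
        · have hda' : (0 : ℝ) < d a := by exact_mod_cast hda
          exact div_nonneg (h₁ a ha hda.le) hda'.le
        · have hda' : (0 : ℝ) < d a := by exact_mod_cast hda
          have hdb' : (d b : ℝ) < 0 := by exact_mod_cast hdb
          rw [le_div_iff₀ hda', div_mul_eq_mul_div, div_le_iff_of_neg hdb']
          linarith [h₂ a ha hda b hb hdb]) (Finset.insert_nonempty _ _)
    refine ⟨s, hs 0 (Finset.mem_insert_self _ _), fun a ha => ?_⟩
    rw [hd, sub_nonneg]
    rcases lt_trichotomy (d a) 0 with hda | hda | hda
    · have hda' : (d a : ℝ) < 0 := by exact_mod_cast hda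
      rw [← div_le_iff_of_neg hda']
      exact hs _ (Finset.mem_insert_of_mem (Finset.mem_image_of_mem _
        (Finset.mem_filter.2 ⟨ha, hda⟩)))
    · rw [hda, Rat.cast_zero, mul_zero]
      exact h₁ a ha hda.ge
    · have hda' : (0 : ℝ) < d a := by exact_mod_cast hda
      rw [← le_div_iff₀ hda']
      exact hs' _ (Finset.mem_image_of_mem _ (Finset.mem_filter.2 ⟨ha, hda⟩))
  · rintro ⟨s, hs, h⟩ c hc
    simp only [hd, sub_nonneg] at h
    simp only [Finset.mem_union, Finset.mem_filter, Finset.mem_image₂] at hc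
    rcases hc with ⟨hc, hdc⟩ | ⟨a, ⟨ha, hda⟩, b, ⟨hb, hdb⟩, rfl⟩
    · have hdc' : (0 : ℝ) ≤ d c := by exact_mod_cast hdc
      exact (mul_nonneg hs hdc').trans (h c hc)
    · have hda' : (0 : ℝ) < d a := by exact_mod_cast hda
      have hdb' : (d b : ℝ) < 0 := by exact_mod_cast hdb
      rw [ratForm_add_smul, Rat.cast_neg]
      have h₁ := mul_le_mul_of_nonneg_left (h a ha) (neg_pos.2 hdb').le
      have h₂ := mul_le_mul_of_nonneg_left (h b hb) hda'.le
      linarith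

/-- **Weyl's theorem** over `ℚ`: a cone generated by finitely many rational vectors is cut out by
finitely many rational half-spaces. -/
theorem exists_halfspaces_eq_cone {ι κ : Type*} [Fintype ι] (V : Finset κ) (u : κ → ι → ℚ) :
    ∃ F : Finset (ι → ℚ), ∀ x : ι → ℝ, (∀ a ∈ F, 0 ≤ ratForm a x) ↔
      ∃ w : κ → ℝ, (∀ v ∈ V, 0 ≤ w v) ∧ ∑ v ∈ V, w v • (fun i => (u v i : ℝ)) = x := by
  classical
  induction V using Finset.induction_on with
  | empty =>
    refine ⟨Finset.univ.image (fun i => Pi.single i 1) ∪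
      Finset.univ.image fun i => Pi.single i (-1),
      fun x => ?_⟩
    have hsingle : ∀ i (c : ℚ), ratForm (Pi.single i c) x = c * x i := fun i c => by
      rw [ratForm, Finset.sum_eq_single i] <;> simp +contextual
    simp only [Finset.sum_empty, Finset.notMem_empty, IsEmpty.forall_iff, implies_true, true_and,
      exists_const]
    constructor
    · intro h
      ext i
      have h₁ := h (Pi.single i 1) (by simp)
      have h₂ := h (Pi.single i (-1)) (by simp)
      rw [hsingle] at h₁ h₂
      push_cast at h₁ h₂
      simp only [Pi.zero_apply]
      linarith
    · rintro rfl a _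
      simp [ratForm]
  | insert v V hv ih =>
    obtain ⟨F, hF⟩ := ih
    obtain ⟨F', hF'⟩ := exists_halfspaces_add_ray F (u v)
    refine ⟨F', fun x => ?_⟩
    simp_rw [hF', hF, Finset.sum_insert hv, Finset.forall_mem_insert]
    constructor
    · rintro ⟨s, hs, w, hw, hx⟩
      have hne : ∀ v' ∈ V, v' ≠ v := fun v' hv' h => hv (h ▸ hv')
      refine ⟨Function.update w v s, ⟨by simpa, fun v' hv' => ?_⟩, ?_⟩
      · rw [Function.update_of_ne (hne v' hv')]
        exact hw v' hv'
      · rw [Finset.sum_congr rfl fun v' hv' => by rw [Function.update_of_ne (hne v' hv')], hx]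
        simp
    · rintro ⟨w, ⟨hv', hw⟩, rfl⟩
      exact ⟨w v, hv', w, hw, by simp⟩

theorem exists_int_ratForm {ι : Type*} [Fintype ι] (a : ι → ℚ) :
    ∃ b : ι → ℤ, ∀ x : ι → ℝ, 0 ≤ ratForm a x ↔ 0 ≤ ∑ i, (b i : ℝ) * x i := by
  have hD : 0 < ∏ i, (a i).den := Finset.prod_pos fun i _ => (a i).den_pos
  have h : ∀ i, ∃ b : ℤ, (b : ℝ) = (∏ i, (a i).den : ℕ) * (a i : ℝ) := fun i => by
    obtain ⟨k, hk⟩ := Finset.dvd_prod_of_mem (fun i => (a i).den) (Finset.mem_univ i)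
    refine ⟨k * (a i).num, ?_⟩
    have : (a i : ℚ) * (a i).den = (a i).num := Rat.mul_den_eq_num _
    have h' : (a i : ℝ) * (a i).den = (a i).num := by exact_mod_cast this
    rw [hk]
    push_cast
    rw [← h']
    ring
  choose b hb using h
  refine ⟨b, fun x => ?_⟩
  simp_rw [hb, mul_assoc, ← Finset.mul_sum]
  exact (mul_nonneg_iff_of_pos_left (by exact_mod_cast hD)).symm

/-- The convex hull of finitely many rational points is cut out by finitely many integral affine
inequalities. -/
theorem exists_halfspaces_eq_convexHull {n : ℕ} (V : Finset (Fin n → ℚ)) :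
    ∃ F : Finset (Fin (n + 1) → ℤ), ∀ x : Fin n → ℝ,
      x ∈ convexHull ℝ ((fun v : Fin n → ℚ => fun i => ((v i : ℚ) : ℝ)) '' (V : Set (Fin n → ℚ))) ↔
        ∀ a ∈ F, 0 ≤ (a 0 : ℝ) + ∑ i : Fin n, (a i.succ : ℝ) * x i := by
  classical
  obtain ⟨F, hF⟩ := exists_halfspaces_eq_cone V fun v => (Fin.cons 1 v : Fin (n + 1) → ℚ)
  choose b hb using fun a : Fin (n + 1) → ℚ => exists_int_ratForm a
  refine ⟨F.image b, fun x => ?_⟩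
  have hinj : Set.InjOn (fun v : Fin n → ℚ => fun i => ((v i : ℚ) : ℝ)) V := fun v _ w _ h =>
    funext fun i => Rat.cast_injective (congrFun h i)
  have hx := hF (Fin.cons 1 x)
  simp_rw [hb, Fin.sum_univ_succ, Fin.cons_zero, Fin.cons_succ, mul_one] at hx
  rw [Finset.forall_mem_image, hx, ← Finset.coe_image, Finset.mem_convexHull']
  constructor
  · rintro ⟨w, hw, hsum, hx⟩
    rw [Finset.sum_image hinj] at hsum hx
    refine ⟨fun v => w fun i => (v i : ℝ), fun v hv => hw _ (Finset.mem_image_of_mem _ hv), ?_⟩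
    ext i
    refine Fin.cases ?_ (fun i => ?_) i
    · simpa using hsum
    · simpa using congrFun hx i
  · rintro ⟨w, hw, hx⟩
    obtain ⟨w', hw'⟩ : ∃ w' : (Fin n → ℝ) → ℝ, ∀ v ∈ V, w' (fun i => ((v i : ℚ) : ℝ)) = w v :=
      ⟨fun y => w (Function.invFunOn (fun v : Fin n → ℚ => fun i => ((v i : ℚ) : ℝ)) V y),
        fun v hv => congrArg w (hinj.leftInvOn_invFunOn hv)⟩
    refine ⟨w', ?_, ?_, ?_⟩
    · rw [Finset.forall_mem_image]
      intro v hv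
      rw [hw' v hv]
      exact hw v hv
    · rw [Finset.sum_image hinj, Finset.sum_congr rfl hw']
      simpa using congrFun hx 0
    · rw [Finset.sum_image hinj, Finset.sum_congr rfl fun v hv =>
        congrArg (· • fun i => ((v i : ℚ) : ℝ)) (hw' v hv)]
      ext i
      simpa using congrFun hx i.succ

/-- The set of lattice points `z` with `z ∈ t • P`. -/
def dilationLatticePoints {n : ℕ} (P : Set (Fin n → ℝ)) (t : ℕ) : Set (Fin n → ℤ) :=
  {x : Fin n → ℤ | (fun i => ((x i : ℤ) : ℝ)) ∈ (t : ℝ) • P}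

theorem mem_dilationLatticePoints {n : ℕ} {P : Set (Fin n → ℝ)} {t : ℕ} (ht : 0 < t)
    {z : Fin n → ℤ} :
    z ∈ dilationLatticePoints P t ↔ (t : ℝ)⁻¹ • (fun i => ((z i : ℤ) : ℝ)) ∈ P :=
  Set.mem_smul_set_iff_inv_smul_mem₀ (by positivity) _ _

theorem exists_mem_piecewiseQuasiPoly_eq_card {n : ℕ} {P : Set (Fin n → ℝ)}
    (hP : Bornology.IsBounded P) {F : Finset (Fin (n + 1) → ℤ)}
    (hF : ∀ x : Fin n → ℝ, x ∈ P ↔ ∀ a ∈ F, 0 ≤ (a 0 : ℝ) + ∑ i : Fin n, (a i.succ : ℝ) * x i) :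
    ∃ f ∈ piecewiseQuasiPoly ℤ, ∀ t : ℕ, 0 < t →
      (Nat.card (dilationLatticePoints P t) : ℝ) = f t := by
  classical
  obtain ⟨R, hR⟩ := hP.exists_norm_le
  let l : (Fin (n + 1) → ℤ) → ℤ × (Fin n → ℤ) →+ ℤ := fun a =>
    AddMonoidHom.mk' (fun z => a 0 * z.1 + ∑ i : Fin n, a i.succ * z.2 i) fun z w => by
      simp only [Prod.fst_add, Prod.snd_add, Pi.add_apply, mul_add, Finset.sum_add_distrib]
      ring
  have hl : ∀ a t (z : Fin n → ℤ), l a (t, z) = a 0 * t + ∑ i : Fin n, a i.succ * z i :=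
    fun _ _ _ => rfl
  let τ : ℤ →+ ℤ := AddMonoidHom.mulLeft (⌈R⌉₊ : ℤ)
  have hmem : ∀ t : ℕ, 0 < t → ∀ z, z ∈ dilationLatticePoints P t ↔ ∀ a ∈ F, 0 ≤ l a (t, z) := by
    intro t ht z
    have ht' : (0 : ℝ) < t := by exact_mod_cast ht
    rw [mem_dilationLatticePoints ht, hF]
    refine forall₂_congr fun a _ => ?_
    rw [← mul_nonneg_iff_of_pos_left ht', mul_add, Finset.mul_sum, hl,
      ← Int.cast_nonneg_iff (R := ℝ)]
    push_cast
    rw [mul_comm (t : ℝ)]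
    have : ∀ i : Fin n, (t : ℝ) * ((a i.succ : ℝ) * ((t : ℝ)⁻¹ • fun i => ((z i : ℤ) : ℝ)) i) =
        (a i.succ : ℝ) * z i := fun i => by
      simp only [Pi.smul_apply, smul_eq_mul]
      field_simp
    simp only [this]
  have hbox : ∀ t : ℕ, 0 < t → ∀ z ∈ dilationLatticePoints P t,
      z ∈ Fintype.piFinset fun _ : Fin n => Finset.Icc (-τ t) (τ t) := by
    intro t ht z hz
    have ht' : (0 : ℝ) < t := by exact_mod_cast ht
    rw [Fintype.mem_piFinset]
    intro i
    have h := (norm_le_pi_norm _ i).trans (hR _ ((mem_dilationLatticePoints ht).1 hz))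
    have h' : |(z i : ℝ)| ≤ ⌈R⌉₊ * t := by
      rw [Pi.smul_apply, smul_eq_mul, Real.norm_eq_abs, abs_mul, abs_inv, abs_of_pos ht',
        inv_mul_le_iff₀ ht', mul_comm] at h
      exact h.trans (mul_le_mul_of_nonneg_right (Nat.le_ceil R) ht'.le)
    rw [Finset.mem_Icc, ← abs_le]
    exact_mod_cast h'
  refine ⟨_, piecewiseQuasiPoly.sum_piFinset_Icc_mem (piecewiseQuasiPoly.prod_mem' F fun a _ =>
    piecewiseQuasiPoly.indicator_mem (l a)) τ, fun t ht => ?_⟩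
  have hset : dilationLatticePoints P t =
      ((Fintype.piFinset fun _ : Fin n => Finset.Icc (-τ t) (τ t)).filter
        fun z => ∀ a ∈ F, 0 ≤ l a (t, z) : Finset (Fin n → ℤ)) := by
    ext z
    rw [Finset.mem_coe, Finset.mem_filter, ← hmem t ht]
    exact ⟨fun h => ⟨hbox t ht z h, h⟩, fun h => h.2⟩
  rw [hset, Nat.card_coe_set_eq, Set.ncard_coe_finset, Finset.card_filter, Nat.cast_sum]
  refine Finset.sum_congr rfl fun z _ => ?_
  rw [Finset.prod_boole]
  simp

theorem tendsto_card_dilationLatticePoints {n : ℕ} {P : Set (Fin n → ℝ)}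
    (hP : Bornology.IsBounded P) (hm : MeasurableSet P) (hf : volume (frontier P) = 0) :
    Filter.Tendsto (fun t : ℕ => (Nat.card (dilationLatticePoints P t) : ℝ) / (t : ℝ) ^ n)
      Filter.atTop (nhds (volume.real P)) := by
  have h := tendsto_card_div_pow_atTop_volume P hP hm hf
  rw [Fintype.card_fin] at h
  refine h.congr' ?_
  filter_upwards [Filter.eventually_gt_atTop 0] with t ht
  have ht' : (t : ℝ) ≠ 0 := by positivity
  congr 2
  have hinj : Function.Injective fun z : Fin n → ℤ => (t : ℝ)⁻¹ • fun i => ((z i : ℤ) : ℝ) :=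
    fun z w h => funext fun i =>
      Int.cast_injective (congrFun (smul_right_injective _ (inv_ne_zero ht') h) i)
  rw [← Nat.card_image_of_injective hinj]
  congr 2
  ext x
  simp only [Set.mem_inter_iff, Set.mem_image, Set.mem_smul_set, SetLike.mem_coe,
    Module.Basis.mem_span_iff_repr_mem, Pi.basisFun_repr]
  constructor
  · rintro ⟨hx, y, hy, rfl⟩
    choose z hz using hy
    have hz' : (fun i => ((z i : ℤ) : ℝ)) = y := funext hz
    exact ⟨z, (mem_dilationLatticePoints ht).2 (hz' ▸ hx), by rw [hz']⟩
  · rintro ⟨z, hz, rfl⟩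
    exact ⟨(mem_dilationLatticePoints ht).1 hz, _, fun i => ⟨z i, rfl⟩, rfl⟩

theorem degree_eq_and_leadingCoeff_eq_of_tendsto {p : Polynomial ℝ} {n : ℕ} {c : ℝ} (hc : c ≠ 0)
    {u : ℕ → ℝ} (hu : Filter.Tendsto u Filter.atTop Filter.atTop)
    (h : Filter.Tendsto (fun k => p.eval (u k) / u k ^ n) Filter.atTop (nhds c)) :
    p.degree = n ∧ p.leadingCoeff = c := by
  have hX : ∀ x : ℝ, (Polynomial.X ^ n : Polynomial ℝ).eval x = x ^ n := by simp
  simp_rw [← hX] at h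
  rcases lt_trichotomy p.degree (Polynomial.X ^ n : Polynomial ℝ).degree with hlt | heq | hgt
  · exact absurd (tendsto_nhds_unique h
      ((Polynomial.div_tendsto_atTop_zero_of_degree_lt _ _ hlt).comp hu)) hc
  · have := tendsto_nhds_unique h
      ((Polynomial.div_tendsto_atTop_leadingCoeff_div_of_degree_eq _ _ heq).comp hu)
    rw [this]
    simpa using heq
  · exact absurd h.abs (not_tendsto_nhds_of_tendsto_atTop
      ((Polynomial.abs_div_tendsto_atTop_atTop_of_degree_gt _ _ hgt (by simp)).comp hu) _)

/-- **Ehrhart's theorem** for full-dimensional rational polytopes: the lattice-point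
counting function `t ↦ #(tP ∩ ℤ^n)` is a quasipolynomial of degree `n` whose leading
coefficient equals the volume of `P`. -/
theorem ehrhart_rational_polytope (n : ℕ) (V : Finset (Fin n → ℚ))
    (P : Set (Fin n → ℝ))
    (hP : P = convexHull ℝ ((fun v : Fin n → ℚ => fun i => ((v i : ℚ) : ℝ)) '' (V : Set (Fin n → ℚ))))
    (hfull : affineSpan ℝ P = ⊤) :
    ∃ N : ℕ, 0 < N ∧ ∃ p : ℕ → Polynomial ℝ,
      (∀ r < N, (p r).degree = (n : ℕ) ∧ (p r).leadingCoeff = (volume P).toReal) ∧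
      ∀ t : ℕ, 0 < t →
        (Nat.card {x : Fin n → ℤ | (fun i => ((x i : ℤ) : ℝ)) ∈ (t : ℝ) • P} : ℝ) =
          (p (t % N)).eval (t : ℝ) := by
  have hbdd : Bornology.IsBounded P := by
    rw [hP, isBounded_convexHull]
    exact (V.finite_toSet.image _).isBounded
  have hconv : Convex ℝ P := hP ▸ convex_convexHull ℝ _
  have hclosed : IsClosed P := hP ▸ (V.finite_toSet.image _).isClosed_convexHull ℝ
  have hvol : volume.real P ≠ 0 := by
    have hint := hconv.interior_nonempty_iff_affineSpan_eq_top.2 hfull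
    exact (ENNReal.toReal_pos (Measure.measure_pos_of_nonempty_interior _ hint).ne'
      hbdd.measure_lt_top.ne).ne'
  obtain ⟨F, hF⟩ := exists_halfspaces_eq_convexHull V
  rw [← hP] at hF
  obtain ⟨f, hf, hcard⟩ := exists_mem_piecewiseQuasiPoly_eq_card hbdd hF
  obtain ⟨N, hN, p, hp⟩ := piecewiseQuasiPoly.exists_eval_eq hf
  refine ⟨N, hN, p, fun r hr => ?_, fun t ht => (hcard t ht).trans (hp t ht)⟩
  have hu : Filter.Tendsto (fun k : ℕ => N * k + r) Filter.atTop Filter.atTop :=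
    Filter.tendsto_atTop_mono (fun k => (Nat.le_mul_of_pos_left k hN).trans (Nat.le_add_right _ r))
      Filter.tendsto_id
  refine degree_eq_and_leadingCoeff_eq_of_tendsto hvol (tendsto_natCast_atTop_atTop.comp hu)
    (((tendsto_card_dilationLatticePoints hbdd hclosed.measurableSet
      (hconv.addHaar_frontier volume)).comp hu).congr' ?_)
  filter_upwards [Filter.eventually_gt_atTop 0] with k hk
  have hpos : 0 < N * k + r := by positivity
  simp only [Function.comp_apply]
  rw [hcard _ hpos, hp _ hpos, Nat.mul_add_mod, Nat.mod_eq_of_lt hr]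
end

section
/- Let A be an (n+1) × n integer matrix such that every n × n submatrix obtained by deleting one row of A is invertible. For t ∈ ℤ^{n+1} let P^{(t)} = {x ∈ ℝ^n : Ax ≤ t}, and for 1 ≤ i ≤ n+1 let v_i(t) ∈ ℝ^n be the unique point satisfying with equality the n inequalities of P^{(t)} other than the i-th. Let T ⊆ ℤ^{n+1} be the set of those t for which, for every i, the point v_i(t) satisfies the i-th inequality strictly (so that P^{(t)} is a nondegenerate n-dimensional simplex). Then there exist a positive integer N and, for each residue vector r ∈ ({0,…,N−1})^{n+1}, polynomials I_r and J_r in n+1 variables with rational coefficients, such that, setting I(t) = I_{t mod N}(t) and J(t) = J_{t mod N}(t), one has: for every t ∈ T, the number of lattice points in the interior of P^{(t)} equals I(t) and the number of lattice points in P^{(t)} equals J(t); moreover I(−t) = (−1)^n J(t) for all t ∈ ℤ^{n+1} (Ehrhart–Macdonald reciprocity for vector dilations). -/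
open Matrix

/-- The polynomial `s ↦ (s + 1) ⋯ (s + n) / n!`, which equals `(s + n).choose n` on `ℕ`. -/
def shiftedBinom (n : ℕ) (s : ℚ) : ℚ :=
  (n.factorial : ℚ)⁻¹ * ∏ k ∈ Finset.range n, (s + (k + 1))

theorem shiftedBinom_natCast (n s : ℕ) : shiftedBinom n s = (s + n).choose n := by
  have h := Nat.ascFactorial_eq_factorial_mul_choose s n
  rw [Nat.ascFactorial_eq_prod_range] at h
  have h' : ∏ k ∈ Finset.range n, ((s : ℚ) + (k + 1)) = n.factorial * (s + n).choose n := by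
    rw [← Nat.cast_mul, ← h]
    push_cast
    exact Finset.prod_congr rfl fun k _ => by ring
  rw [shiftedBinom, h', inv_mul_cancel_left₀ (by exact_mod_cast n.factorial_ne_zero)]

theorem shiftedBinom_intCast_eq_zero {n : ℕ} {s : ℤ} (h₀ : s < 0) (h₁ : -(n + 1) < s) :
    shiftedBinom n s = 0 := by
  refine mul_eq_zero_of_right _ (Finset.prod_eq_zero (i := (-s - 1).toNat) ?_ ?_)
  · simp only [Finset.mem_range]; omega
  · have : (((-s - 1).toNat : ℤ) : ℚ) = ((-s - 1 : ℤ) : ℚ) := by congr 1; omega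
    rw [Int.cast_natCast] at this
    rw [this]; push_cast; ring

theorem shiftedBinom_reflect (n : ℕ) (s : ℚ) :
    shiftedBinom n (-(n + 1) - s) = (-1) ^ n * shiftedBinom n s := by
  have h : ∏ k ∈ Finset.range n, (-((n : ℚ) + 1) - s + (k + 1))
      = ∏ k ∈ Finset.range n, (-1 * (s + (k + 1))) := by
    rw [← Finset.prod_range_reflect]
    refine Finset.prod_congr rfl fun k hk => ?_
    have hk' : k + 1 ≤ n := Finset.mem_range.mp hk
    rw [Nat.sub_sub, add_comm 1 k, Nat.cast_sub hk']
    push_cast; ring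
  rw [shiftedBinom, shiftedBinom, h, Finset.prod_mul_distrib]
  simp only [Finset.prod_const, Finset.card_range]
  ring

theorem card_piAntidiag_univ (n s : ℕ) :
    (Finset.piAntidiag (Finset.univ : Finset (Fin (n + 1))) s).card = (s + n).choose n := by
  have h := Finset.card_finsuppAntidiag_nat_eq_choose (s := (Finset.univ : Finset (Fin (n + 1)))) s
  simp only [Finset.finsuppAntidiag, Finset.card_map, Finset.card_attach, Finset.card_univ,
    Fintype.card_fin] at h
  rw [h, show n + 1 + s - 1 = s + n by omega, Nat.choose_symm_add]

/-- A lattice `L` in the hyperplane `lam ⬝ᵥ y = 0` modulo which suitable positive multiples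
`c i` of all the standard basis vectors coincide, their common class being that of `w`. -/
structure SlackLattice (n : ℕ) where
  L : AddSubgroup (Fin (n + 1) → ℤ)
  w : Fin (n + 1) → ℤ
  lam : Fin (n + 1) → ℤ
  c : Fin (n + 1) → ℤ
  D : ℤ
  D_pos : 0 < D
  c_pos : ∀ i, 0 < c i
  lam_mul_c : ∀ i, lam i * c i = D
  lam_dot : ∀ y ∈ L, lam ⬝ᵥ y = 0
  single_sub_mem : ∀ i, Pi.single i (c i) - w ∈ L

namespace SlackLattice

variable {n : ℕ} (S : SlackLattice n)

theorem lam_pos (i : Fin (n + 1)) : 0 < S.lam i :=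
  pos_of_mul_pos_left (S.lam_mul_c i ▸ S.D_pos) (S.c_pos i).le

theorem lam_dot_w : S.lam ⬝ᵥ S.w = S.D := by
  have h := S.lam_dot _ (S.single_sub_mem 0)
  rw [dotProduct_sub, dotProduct_single, S.lam_mul_c] at h
  omega

theorem mul_sub_mem (q : Fin (n + 1) → ℤ) : S.c * q - (∑ i, q i) • S.w ∈ S.L := by
  have h : S.c * q - (∑ i, q i) • S.w = ∑ i, q i • (Pi.single i (S.c i) - S.w) := by
    simp only [smul_sub, Finset.sum_sub_distrib, ← Finset.sum_smul]
    congr 1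
    ext j
    simp [Finset.sum_apply, Pi.single_apply, mul_comm]
  rw [h]
  exact S.L.sum_mem fun i _ => S.L.zsmul_mem (S.single_sub_mem i) _

/-- The subgroup generated by `L` and `w`. -/
def K : AddSubgroup (Fin (n + 1) → ℤ) := S.L ⊔ AddSubgroup.zmultiples S.w

theorem mem_K {v : Fin (n + 1) → ℤ} : v ∈ S.K ↔ ∃ s : ℤ, v - s • S.w ∈ S.L := by
  simp only [K, AddSubgroup.mem_sup, AddSubgroup.mem_zmultiples_iff]
  constructor
  · rintro ⟨y, hy, z, ⟨s, rfl⟩, rfl⟩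
    exact ⟨s, by simpa using hy⟩
  · rintro ⟨s, hs⟩
    exact ⟨_, hs, _, ⟨s, rfl⟩, by simp⟩

theorem mul_mem_K (q : Fin (n + 1) → ℤ) : S.c * q ∈ S.K :=
  S.mem_K.2 ⟨_, S.mul_sub_mem q⟩

theorem D_smul_mem_K (q : Fin (n + 1) → ℤ) : S.D • q ∈ S.K := by
  convert S.mul_mem_K (S.lam * q) using 1
  ext i
  simp [← S.lam_mul_c i]; ring

theorem D_mul_eq {v : Fin (n + 1) → ℤ} {s : ℤ} (h : v - s • S.w ∈ S.L) :
    S.lam ⬝ᵥ v = s * S.D := by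
  have h' := S.lam_dot _ h
  rw [dotProduct_sub, dotProduct_smul, S.lam_dot_w, smul_eq_mul] at h'
  omega

/-- The box `∏ i, [0, c i)`. -/
noncomputable def residues : Finset (Fin (n + 1) → ℤ) :=
  Fintype.piFinset fun i => Finset.Ico 0 (S.c i)

theorem mem_residues {ρ : Fin (n + 1) → ℤ} : ρ ∈ S.residues ↔ ∀ i, 0 ≤ ρ i ∧ ρ i < S.c i := by
  simp [residues]

open Classical in
/-- The number of `q : Fin (n + 1) → ℕ` with `v ≡ c * q` modulo `L`, as a quasipolynomial in `v`. -/
noncomputable def residueCount (v : Fin (n + 1) → ℤ) : ℚ :=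
  if v ∈ S.K then shiftedBinom n ((S.lam ⬝ᵥ v : ℤ) / S.D) else 0

/-- The number of nonnegative integer vectors congruent to `u` modulo `L`, as a
quasipolynomial in `u`. -/
noncomputable def count (u : Fin (n + 1) → ℤ) : ℚ := ∑ ρ ∈ S.residues, S.residueCount (u - ρ)

theorem exists_fiber {u ρ : Fin (n + 1) → ℤ} (hu : -∑ i, S.lam i < S.lam ⬝ᵥ u)
    (hρ : ρ ∈ S.residues) :
    ∃ F : Finset (Fin (n + 1) → ℤ),
      (∀ y, y ∈ F ↔ (∀ i, 0 ≤ y i) ∧ u - y ∈ S.L ∧ ∀ i, y i % S.c i = ρ i) ∧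
      (F.card : ℚ) = S.residueCount (u - ρ) := by
  classical
  rw [mem_residues] at hρ
  have hdecomp : ∀ y : Fin (n + 1) → ℤ, (∀ i, y i % S.c i = ρ i) →
      ∃ q : Fin (n + 1) → ℤ, y = ρ + S.c * q := fun y hy =>
    ⟨fun i => y i / S.c i, funext fun i => by
      simp only [Pi.add_apply, Pi.mul_apply, ← hy i, Int.emod_add_mul_ediv]⟩
  have hsub : ∀ q : Fin (n + 1) → ℤ, ∀ s : ℤ,
      u - (ρ + S.c * q) - (s - ∑ i, q i) • S.w
        = (u - ρ - s • S.w) - (S.c * q - (∑ i, q i) • S.w) := fun q s => by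
    rw [sub_smul]; abel
  by_cases hK : u - ρ ∈ S.K
  · obtain ⟨s, hs⟩ := S.mem_K.1 hK
    have hsD := S.D_mul_eq hs
    have hDQ : (S.D : ℚ) ≠ 0 := by exact_mod_cast S.D_pos.ne'
    have hval : S.residueCount (u - ρ) = shiftedBinom n (s : ℚ) := by
      rw [residueCount, if_pos hK, hsD, Int.cast_mul, mul_div_cancel_right₀ _ hDQ]
    have hmem : ∀ q : Fin (n + 1) → ℤ, u - (ρ + S.c * q) ∈ S.L ↔ ∑ i, q i = s := fun q => by
      have h := S.L.sub_mem hs (S.mul_sub_mem q)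
      rw [← hsub] at h
      constructor
      · intro h'
        have h₁ := S.D_mul_eq h
        rw [S.lam_dot _ h'] at h₁
        have := (mul_eq_zero.1 h₁.symm).resolve_right S.D_pos.ne'
        omega
      · intro h'
        simpa [h'] using h
    have hq0 : ∀ q : Fin (n + 1) → ℤ, (∀ i, 0 ≤ (ρ + S.c * q) i) → ∀ i, 0 ≤ q i := by
      intro q hq i
      by_contra hneg
      have h₁ : S.c i * q i ≤ S.c i * (-1) :=
        mul_le_mul_of_nonneg_left (by omega) (S.c_pos i).le
      have h₂ := hq i
      have h₃ := (hρ i).2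
      simp only [Pi.add_apply, Pi.mul_apply] at h₂
      omega
    rcases lt_or_ge s 0 with hs0 | hs0
    · refine ⟨∅, fun y => ⟨by simp, ?_⟩, ?_⟩
      · rintro ⟨hy0, hyL, hyρ⟩
        obtain ⟨q, rfl⟩ := hdecomp y hyρ
        have h₁ := (hmem q).1 hyL
        have h₂ := Finset.sum_nonneg fun i (_ : i ∈ Finset.univ) => hq0 q hy0 i
        omega
      · rw [hval, shiftedBinom_intCast_eq_zero hs0]
        · simp
        · have h₁ : S.lam ⬝ᵥ ρ ≤ ∑ i, (S.D - S.lam i) := by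
            refine Finset.sum_le_sum fun i _ => ?_
            have h₂ : S.lam i * ρ i ≤ S.lam i * (S.c i - 1) :=
              mul_le_mul_of_nonneg_left (by have := (hρ i).2; omega) (S.lam_pos i).le
            rwa [mul_sub, S.lam_mul_c, mul_one] at h₂
          simp only [Finset.sum_sub_distrib, Finset.sum_const, Finset.card_univ,
            Fintype.card_fin, nsmul_eq_mul] at h₁
          rw [dotProduct_sub] at hsD
          have h₃ : (-(n + 1 : ℤ)) * S.D < s * S.D := by
            push_cast at h₁
            linarith
          exact lt_of_mul_lt_mul_right h₃ S.D_pos.le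
    · lift s to ℕ using hs0
      have hinj : Function.Injective
          (fun q : Fin (n + 1) → ℕ => ρ + S.c * (fun i => (q i : ℤ))) := by
        intro q q' h
        funext i
        have := congrFun h i
        simp only [Pi.add_apply, Pi.mul_apply, add_right_inj] at this
        exact_mod_cast mul_left_cancel₀ (S.c_pos i).ne' this
      refine ⟨(Finset.piAntidiag Finset.univ s).image
        (fun q : Fin (n + 1) → ℕ => ρ + S.c * (fun i => (q i : ℤ))), fun y => ?_, ?_⟩
      · simp only [Finset.mem_image, Finset.mem_piAntidiag, Finset.mem_univ, implies_true,
          and_true]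
        constructor
        · rintro ⟨q, hq, rfl⟩
          refine ⟨fun i => ?_, (hmem _).2 (by exact_mod_cast hq), fun i => ?_⟩
          · have h₁ := (hρ i).1
            have h₂ := S.c_pos i
            simp only [Pi.add_apply, Pi.mul_apply]
            positivity
          · simp [Int.emod_eq_of_lt (hρ i).1 (hρ i).2]
        · rintro ⟨hy0, hyL, hyρ⟩
          obtain ⟨q, rfl⟩ := hdecomp y hyρ
          have h₁ := (hmem q).1 hyL
          have h₂ := hq0 q hy0
          lift q to Fin (n + 1) → ℕ using h₂
          refine ⟨q, ?_, rfl⟩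
          beta_reduce at h₁
          exact_mod_cast h₁
      · rw [Finset.card_image_of_injective _ hinj, card_piAntidiag_univ, hval,
          Int.cast_natCast, shiftedBinom_natCast]
  · refine ⟨∅, fun y => ⟨by simp, ?_⟩, by simp [residueCount, hK]⟩
    rintro ⟨-, hyL, hyρ⟩
    obtain ⟨q, rfl⟩ := hdecomp y hyρ
    refine (hK (S.mem_K.2 ⟨∑ i, q i, ?_⟩)).elim
    have h := S.L.add_mem hyL (S.mul_sub_mem q)
    convert h using 1
    abel

theorem ncard_eq_count {u : Fin (n + 1) → ℤ} (hu : -∑ i, S.lam i < S.lam ⬝ᵥ u) :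
    ({y : Fin (n + 1) → ℤ | (∀ i, 0 ≤ y i) ∧ u - y ∈ S.L}.ncard : ℚ) = S.count u := by
  classical
  choose! F hF hcard using fun ρ (hρ : ρ ∈ S.residues) => S.exists_fiber hu hρ
  have hset : {y : Fin (n + 1) → ℤ | (∀ i, 0 ≤ y i) ∧ u - y ∈ S.L}
      = (S.residues.biUnion F : Finset (Fin (n + 1) → ℤ)) := by
    ext y
    simp only [Set.mem_ofPred_eq, Finset.coe_biUnion, Set.mem_iUnion, Finset.mem_coe, exists_prop]
    constructor
    · rintro ⟨h₁, h₂⟩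
      have hres : (fun i => y i % S.c i) ∈ S.residues := S.mem_residues.2 fun i =>
        ⟨Int.emod_nonneg _ (S.c_pos i).ne', Int.emod_lt_of_pos _ (S.c_pos i)⟩
      exact ⟨_, hres, (hF _ hres y).2 ⟨h₁, h₂, fun _ => rfl⟩⟩
    · rintro ⟨ρ, hρ, hy⟩
      have := (hF ρ hρ y).1 hy
      exact ⟨this.1, this.2.1⟩
  rw [hset, Set.ncard_coe_finset, Finset.card_biUnion, Nat.cast_sum, count]
  · exact Finset.sum_congr rfl hcard
  · intro ρ hρ ρ' hρ' hne
    rw [Function.onFun, Finset.disjoint_left]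
    intro y hy hy'
    exact hne (funext fun i =>
      (((hF ρ hρ y).1 hy).2.2 i).symm.trans (((hF ρ' hρ' y).1 hy').2.2 i))

theorem count_reflect (u : Fin (n + 1) → ℤ) : S.count (-u - 1) = (-1) ^ n * S.count u := by
  rw [count, count, Finset.mul_sum]
  have hmem : ∀ ρ ∈ S.residues, S.c - 1 - ρ ∈ S.residues := fun ρ hρ => by
    rw [mem_residues] at hρ ⊢
    intro i
    have := hρ i
    simp only [Pi.sub_apply, Pi.one_apply]
    omega
  refine Finset.sum_bij' (fun ρ _ => S.c - 1 - ρ) (fun ρ _ => S.c - 1 - ρ) hmem hmem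
    (fun ρ _ => by abel) (fun ρ _ => by abel) fun ρ _ => ?_
  have hv : -u - 1 - ρ = -(u - (S.c - 1 - ρ)) - S.c * 1 := by rw [mul_one]; abel
  have hiff : -u - 1 - ρ ∈ S.K ↔ u - (S.c - 1 - ρ) ∈ S.K := by
    rw [hv, sub_eq_add_neg, AddSubgroup.add_mem_cancel_right _ (neg_mem (S.mul_mem_K 1)),
      neg_mem_iff]
  by_cases h : u - (S.c - 1 - ρ) ∈ S.K
  · rw [residueCount, residueCount, if_pos (hiff.2 h), if_pos h, ← shiftedBinom_reflect]
    congr 1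
    have hD : (S.D : ℚ) ≠ 0 := by exact_mod_cast S.D_pos.ne'
    have hc : S.lam ⬝ᵥ S.c = (n + 1) * S.D := by
      simp [dotProduct, S.lam_mul_c]
    rw [hv, dotProduct_sub, dotProduct_neg, mul_one, hc]
    push_cast
    field_simp
    ring
  · rw [residueCount, residueCount, if_neg (mt hiff.1 h), if_neg h, mul_zero]

open Classical in
/-- For fixed `a`, the polynomial agreeing with `t ↦ S.count (t - a)` for `t ≡ r` modulo `D`. -/
noncomputable def countPoly (a r : Fin (n + 1) → ℤ) : MvPolynomial (Fin (n + 1)) ℚ :=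
  ∑ ρ ∈ S.residues, if r - a - ρ ∈ S.K then
    MvPolynomial.C (n.factorial : ℚ)⁻¹ * ∏ k ∈ Finset.range n,
      (MvPolynomial.C (S.D : ℚ)⁻¹ * (∑ i, MvPolynomial.C (S.lam i : ℚ) *
        (MvPolynomial.X i - MvPolynomial.C (a i : ℚ) - MvPolynomial.C (ρ i : ℚ)))
        + MvPolynomial.C ((k : ℚ) + 1))
    else 0

theorem eval_countPoly (a t : Fin (n + 1) → ℤ) :
    MvPolynomial.eval (fun r => (t r : ℚ)) (S.countPoly a fun r => t r % S.D)
      = S.count (t - a) := by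
  rw [countPoly, count, map_sum]
  refine Finset.sum_congr rfl fun ρ _ => ?_
  have hiff : (fun r => t r % S.D) - a - ρ ∈ S.K ↔ t - a - ρ ∈ S.K := by
    have h : t - a - ρ = (fun r => t r % S.D) - a - ρ + S.D • (fun r => t r / S.D) := by
      ext i
      have := Int.emod_add_mul_ediv (t i) S.D
      simp only [Pi.sub_apply, Pi.add_apply, Pi.smul_apply, smul_eq_mul]
      omega
    rw [h, AddSubgroup.add_mem_cancel_right _ (S.D_smul_mem_K _)]
  by_cases h : t - a - ρ ∈ S.K
  · rw [residueCount, if_pos (hiff.2 h), if_pos h]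
    simp only [map_mul, map_prod, map_add, map_sum, map_sub, MvPolynomial.eval_C,
      MvPolynomial.eval_X, shiftedBinom, dotProduct, Int.cast_sum, Int.cast_mul, Pi.sub_apply,
      Int.cast_sub, div_eq_inv_mul]
  · rw [residueCount, if_neg (mt hiff.1 h), if_neg h, map_zero]

end SlackLattice

section Relation

variable {n : ℕ} {A : Matrix (Fin (n + 1)) (Fin n) ℤ}

theorem exists_relation (hA : ∀ i : Fin (n + 1), (A.submatrix i.succAbove id).det ≠ 0) :
    ∃ v : Fin (n + 1) → ℤ, v ᵥ* A = 0 ∧ ∀ i, v i ≠ 0 := by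
  let B : Matrix (Fin (n + 1)) (Fin (n + 1)) ℤ := fun i => Fin.cons 0 (A i)
  have hB : B.det = 0 := Matrix.det_eq_zero_of_column_eq_zero 0 fun i => by simp [B]
  obtain ⟨v, hv0, hv⟩ := Matrix.exists_vecMul_eq_zero_iff.2 hB
  have hvA : v ᵥ* A = 0 := by
    ext j
    have := congrFun hv j.succ
    simpa [Matrix.vecMul, dotProduct, B] using this
  refine ⟨v, hvA, fun i hi => hv0 ?_⟩
  have hsub : (fun j => v (i.succAbove j)) = 0 := by
    refine Matrix.eq_zero_of_vecMul_eq_zero (hA i) ?_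
    ext j
    have := congrFun hvA j
    simpa [Matrix.vecMul, dotProduct, Fin.sum_univ_succAbove _ i, hi] using this
  funext j
  exact (Fin.forall_iff_succAbove (P := fun j => v j = 0) i).2 ⟨hi, congrFun hsub⟩ j

theorem dot_mulVec {v : Fin (n + 1) → ℤ} (hv : v ᵥ* A = 0) (x : Fin n → ℤ) :
    v ⬝ᵥ A *ᵥ x = 0 := by
  rw [Matrix.dotProduct_mulVec, hv, zero_dotProduct]

theorem mulVec_injective_of_det (hA : ∀ i : Fin (n + 1), (A.submatrix i.succAbove id).det ≠ 0) :
    Function.Injective A.mulVec := by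
  intro x y hxy
  refine sub_eq_zero.1 (Matrix.eq_zero_of_mulVec_eq_zero (hA 0) ?_)
  ext j
  have := congrFun hxy (Fin.succAbove 0 j)
  rw [Matrix.mulVec_sub]
  exact sub_eq_zero.2 this

theorem exists_mulVec_eq_smul {v y : Fin (n + 1) → ℤ} (hv : v ᵥ* A = 0)
    (hv0 : ∀ i, v i ≠ 0) (hy : v ⬝ᵥ y = 0) :
    ∃ x, A *ᵥ x = (A.submatrix (Fin.succAbove 0) id).det • y := by
  set A₀ := A.submatrix (Fin.succAbove 0) id
  refine ⟨A₀.adjugate *ᵥ fun j => y (Fin.succAbove 0 j), ?_⟩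
  set x := A₀.adjugate *ᵥ fun j => y (Fin.succAbove 0 j)
  have hx : ∀ j, (A *ᵥ x) (Fin.succAbove 0 j) = A₀.det * y (Fin.succAbove 0 j) := fun j => by
    have h : A₀ *ᵥ x = A₀.det • fun j => y (Fin.succAbove 0 j) := by
      simp [x, Matrix.mulVec_mulVec, Matrix.mul_adjugate]
    exact congrFun h j
  have h0 : v ⬝ᵥ (A *ᵥ x - A₀.det • y) = 0 := by
    rw [dotProduct_sub, dot_mulVec hv, dotProduct_smul, hy]; simp
  rw [dotProduct, Fin.sum_univ_succAbove _ 0] at h0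
  simp only [Pi.sub_apply, hx, Pi.smul_apply, smul_eq_mul, sub_self, mul_zero,
    Finset.sum_const_zero, add_zero] at h0
  have h1 := (mul_eq_zero.1 h0).resolve_left (hv0 0)
  funext i
  refine (Fin.forall_iff_succAbove
    (P := fun i => (A *ᵥ x) i = (A₀.det • y) i) 0).2 ⟨?_, hx⟩ i
  simpa using sub_eq_zero.1 h1

/-- The slack lattice of the column span of `A`. -/
theorem exists_slackLattice (hA : ∀ i : Fin (n + 1), (A.submatrix i.succAbove id).det ≠ 0)
    {v : Fin (n + 1) → ℤ} (hv : v ᵥ* A = 0) (hv0 : ∀ i, 0 < v i) :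
    ∃ S : SlackLattice n, S.lam = v ∧ ∀ y, y ∈ S.L ↔ ∃ x, A *ᵥ x = y := by
  set d := (A.submatrix (Fin.succAbove 0) id).det with hd
  have hd0 : 0 < |d| := abs_pos.2 (hA 0)
  let e : Fin (n + 1) → ℤ := fun i => ∏ j ∈ Finset.univ.erase i, v j
  have he : ∀ i, v i * e i = ∏ j, v j := fun i =>
    Finset.mul_prod_erase _ _ (Finset.mem_univ i)
  have hdot : ∀ i, v ⬝ᵥ (Pi.single i (e i) - Pi.single 0 (e 0)) = 0 := fun i => by
    rw [dotProduct_sub, dotProduct_single, dotProduct_single, he, he, sub_self]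
  have hL : ∀ y, y ∈ A.mulVecLin.range.toAddSubgroup ↔ ∃ x, A *ᵥ x = y := fun y => Iff.rfl
  refine ⟨{
    L := A.mulVecLin.range.toAddSubgroup
    w := Pi.single 0 (|d| * e 0)
    lam := v
    c := fun i => |d| * e i
    D := |d| * ∏ j, v j
    D_pos := mul_pos hd0 (Finset.prod_pos fun j _ => hv0 j)
    c_pos := fun i => mul_pos hd0 (Finset.prod_pos fun j _ => hv0 j)
    lam_mul_c := fun i => by rw [mul_left_comm, he]
    lam_dot := ?_
    single_sub_mem := ?_ }, rfl, hL⟩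
  · intro y hy
    obtain ⟨x, rfl⟩ := (hL y).1 hy
    exact dot_mulVec hv x
  · intro i
    obtain ⟨x, hx⟩ := exists_mulVec_eq_smul hv (fun i => (hv0 i).ne') (hdot i)
    rw [← hd] at hx
    have h : (Pi.single i (|d| * e i) - Pi.single 0 (|d| * e 0) : Fin (n + 1) → ℤ)
        = |d| • (Pi.single i (e i) - Pi.single 0 (e 0)) := by
      rw [smul_sub, ← Pi.single_smul', ← Pi.single_smul', smul_eq_mul, smul_eq_mul]
    rw [h]
    rcases abs_choice d with h' | h' <;> rw [h', hL]
    · exact ⟨x, hx⟩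
    · exact ⟨-x, by rw [Matrix.mulVec_neg, hx, neg_smul]⟩

theorem ncard_mulVec_le_eq_count
    (hA : ∀ i : Fin (n + 1), (A.submatrix i.succAbove id).det ≠ 0) (S : SlackLattice n)
    (hS : ∀ y, y ∈ S.L ↔ ∃ x, A *ᵥ x = y) {u : Fin (n + 1) → ℤ}
    (hu : -∑ i, S.lam i < S.lam ⬝ᵥ u) :
    ({x : Fin n → ℤ | ∀ i, (A *ᵥ x) i ≤ u i}.ncard : ℚ) = S.count u := by
  rw [← S.ncard_eq_count hu]
  have hinj : Function.Injective fun x => u - A *ᵥ x := fun x y h =>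
    mulVec_injective_of_det hA (sub_right_injective h)
  rw [← Set.ncard_image_of_injective _ hinj]
  congr 2
  ext y
  simp only [Set.mem_image, Set.mem_ofPred_eq, hS]
  constructor
  · rintro ⟨x, hx, rfl⟩
    exact ⟨fun i => sub_nonneg.2 (hx i), x, by abel⟩
  · rintro ⟨hy, x, hx⟩
    refine ⟨x, fun i => ?_, by rw [hx]; abel⟩
    rw [hx]
    simpa using hy i

theorem map_mulVec_intCast (A : Matrix (Fin (n + 1)) (Fin n) ℤ) (x : Fin n → ℤ)
    (i : Fin (n + 1)) :
    (A.map (Int.cast : ℤ → ℝ) *ᵥ fun j => (x j : ℝ)) i = ((A *ᵥ x) i : ℝ) := by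
  simp [Matrix.mulVec, dotProduct]

theorem interior_mulVec_le (hA : ∀ i : Fin (n + 1), (A.submatrix i.succAbove id).det ≠ 0)
    (t : Fin (n + 1) → ℝ) (hn : n ≠ 0) :
    interior {x : Fin n → ℝ | ∀ i, (A.map (Int.cast : ℤ → ℝ) *ᵥ x) i ≤ t i}
      = {x | ∀ i, (A.map (Int.cast : ℤ → ℝ) *ᵥ x) i < t i} := by
  have hset : {x : Fin n → ℝ | ∀ i, (A.map (Int.cast : ℤ → ℝ) *ᵥ x) i ≤ t i}
      = ⋂ i, (fun x => (A.map (Int.cast : ℤ → ℝ) *ᵥ x) i) ⁻¹' Set.Iic (t i) := by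
    ext; simp
  rw [hset, interior_iInter_of_finite]
  ext x
  simp only [Set.mem_iInter, Set.mem_ofPred_eq]
  refine forall_congr' fun i => ?_
  have hrow : A i ≠ 0 := by
    obtain ⟨k, hk⟩ : ∃ k : Fin (n + 1), k ≠ i := by
      have : Nontrivial (Fin (n + 1)) := Fin.nontrivial_iff_two_le.2 (by omega)
      exact exists_ne i
    obtain ⟨j, hj⟩ := Fin.exists_succAbove_eq hk.symm
    intro h
    refine hA k (Matrix.det_eq_zero_of_row_eq_zero j fun l => ?_)
    simp [hj, h]
  let f : (Fin n → ℝ) →L[ℝ] ℝ :=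
    (LinearMap.proj i ∘ₗ (A.map (Int.cast : ℤ → ℝ)).mulVecLin).toContinuousLinearMap
  have hf : f ≠ 0 := fun h => hrow <| funext fun j => by
    have h' : f (Pi.single j 1) = 0 := by rw [h]; rfl
    simpa [f] using h'
  have h := (f.isOpenMap_of_ne_zero hf).preimage_interior_eq_interior_preimage f.continuous
    (Set.Iic (t i))
  rw [interior_Iic] at h
  change x ∈ interior (f ⁻¹' Set.Iic (t i)) ↔ _
  rw [← h]
  rfl

theorem exists_real_vertex (hA : ∀ i : Fin (n + 1), (A.submatrix i.succAbove id).det ≠ 0)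
    (t : Fin (n + 1) → ℝ) (i : Fin (n + 1)) :
    ∃ x : Fin n → ℝ, ∀ j : Fin n,
      (A.map (Int.cast : ℤ → ℝ) *ᵥ x) (i.succAbove j) = t (i.succAbove j) := by
  set B : Matrix (Fin n) (Fin n) ℝ := (A.map (Int.cast : ℤ → ℝ)).submatrix i.succAbove id
  have hB : IsUnit B.det := by
    have : B.det = ((A.submatrix i.succAbove id).det : ℝ) := by
      exact (RingHom.map_det (Int.castRingHom ℝ) _).symm
    rw [this]
    exact (Int.cast_ne_zero.2 (hA i)).isUnit
  refine ⟨B⁻¹ *ᵥ fun j => t (i.succAbove j), fun j => ?_⟩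
  have h : B *ᵥ (B⁻¹ *ᵥ fun j => t (i.succAbove j)) = fun j => t (i.succAbove j) := by
    rw [Matrix.mulVec_mulVec, Matrix.mul_nonsing_inv _ hB, Matrix.one_mulVec]
  exact congrFun h j

theorem relation_mul_dot_pos (hA : ∀ i : Fin (n + 1), (A.submatrix i.succAbove id).det ≠ 0)
    {v t : Fin (n + 1) → ℤ} (hv : v ᵥ* A = 0) (hv0 : ∀ i, v i ≠ 0) (i : Fin (n + 1))
    (ht : ∀ x : Fin n → ℝ,
      (∀ j : Fin n, (A.map (Int.cast : ℤ → ℝ) *ᵥ x) (i.succAbove j) = (t (i.succAbove j) : ℝ)) →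
      (A.map (Int.cast : ℤ → ℝ) *ᵥ x) i < (t i : ℝ)) :
    0 < v i * (v ⬝ᵥ t) := by
  obtain ⟨x, hx⟩ := exists_real_vertex hA (fun r => (t r : ℝ)) i
  have hlt := ht x hx
  have hvR : (fun r => (v r : ℝ)) ᵥ* A.map (Int.cast : ℤ → ℝ) = 0 := by
    ext j
    have := congrArg (Int.cast : ℤ → ℝ) (congrFun hv j)
    simpa [Matrix.vecMul, dotProduct] using this
  have h0 : (fun r => (v r : ℝ)) ⬝ᵥ A.map (Int.cast : ℤ → ℝ) *ᵥ x = 0 := by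
    rw [Matrix.dotProduct_mulVec, hvR, zero_dotProduct]
  have h1 : ((v ⬝ᵥ t : ℤ) : ℝ) = v i * (t i - (A.map (Int.cast : ℤ → ℝ) *ᵥ x) i) := by
    rw [dotProduct, Fin.sum_univ_succAbove _ i] at h0
    simp only [hx] at h0
    rw [dotProduct, Fin.sum_univ_succAbove _ i]
    push_cast
    linarith
  have h2 : (0 : ℝ) < ((v i * (v ⬝ᵥ t) : ℤ) : ℝ) := by
    rw [Int.cast_mul, h1, ← mul_assoc]
    exact mul_pos (mul_self_pos.2 (Int.cast_ne_zero.2 (hv0 i))) (sub_pos.2 hlt)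
  exact_mod_cast h2

end Relation

/-- **Beck's theorem** on vector-dilated rational simplices: for an `(n+1) × n` integer
matrix `A` all of whose maximal square submatrices are invertible, the interior and closed
lattice-point counts of the vector-dilated simplex `P^{(t)} = {x : Ax ≤ t}` are multivariate
quasipolynomials in `t`, satisfying the Ehrhart–Macdonald reciprocity `i(-t) = (-1)^n j(t)`. -/
theorem beck_vector_dilated_simplex (n : ℕ) (A : Matrix (Fin (n + 1)) (Fin n) ℤ)
    (hA : ∀ i : Fin (n + 1), (A.submatrix i.succAbove id).det ≠ 0) :
    ∃ N : ℕ, 0 < N ∧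
      ∃ I J : (Fin (n + 1) → ℤ) → MvPolynomial (Fin (n + 1)) ℚ,
        -- the real matrix and the vector-dilated polytope
        (fun (Aℝ : Matrix (Fin (n + 1)) (Fin n) ℝ)
             (P : (Fin (n + 1) → ℤ) → Set (Fin n → ℝ))
             (T : Set (Fin (n + 1) → ℤ))
             (Ifun Jfun : (Fin (n + 1) → ℤ) → ℚ) =>
          (∀ t ∈ T,
              (Nat.card {x : Fin n → ℤ | (fun i => ((x i : ℤ) : ℝ)) ∈ interior (P t)} : ℚ)
                = Ifun t ∧
              (Nat.card {x : Fin n → ℤ | (fun i => ((x i : ℤ) : ℝ)) ∈ P t} : ℚ)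
                = Jfun t) ∧
          (∀ t : Fin (n + 1) → ℤ, Ifun (-t) = (-1) ^ n * Jfun t))
          (A.map (Int.cast : ℤ → ℝ))
          (fun t => {x : Fin n → ℝ | ∀ r : Fin (n + 1),
            (A.map (Int.cast : ℤ → ℝ)).mulVec x r ≤ (t r : ℝ)})
          -- `T`: the dilation vectors for which each vertex `v_i(t)` (the solution of the
          -- `n` equalities other than the `i`-th) satisfies the `i`-th inequality strictly
          {t : Fin (n + 1) → ℤ | ∀ i : Fin (n + 1), ∀ x : Fin n → ℝ,
            (∀ j : Fin n,
              (A.map (Int.cast : ℤ → ℝ)).mulVec x (i.succAbove j) = (t (i.succAbove j) : ℝ)) →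
            (A.map (Int.cast : ℤ → ℝ)).mulVec x i < (t i : ℝ)}
          (fun t => MvPolynomial.eval (fun r => (t r : ℚ)) (I fun r => t r % (N : ℤ)))
          (fun t => MvPolynomial.eval (fun r => (t r : ℚ)) (J fun r => t r % (N : ℤ))) := by
  obtain ⟨v, hv, hv0⟩ := exists_relation hA
  beta_reduce
  set T := {t : Fin (n + 1) → ℤ | ∀ i : Fin (n + 1), ∀ x : Fin n → ℝ,
    (∀ j : Fin n,
      (A.map (Int.cast : ℤ → ℝ)).mulVec x (i.succAbove j) = (t (i.succAbove j) : ℝ)) →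
    (A.map (Int.cast : ℤ → ℝ)).mulVec x i < (t i : ℝ)}
  rcases T.eq_empty_or_nonempty with hempty | ⟨t₀, ht₀⟩
  · exact ⟨1, one_pos, 0, 0, by simp [hempty], by simp⟩
  obtain ⟨v, hv, hv0⟩ : ∃ v : Fin (n + 1) → ℤ, v ᵥ* A = 0 ∧ ∀ i, 0 < v i := by
    have h := fun i => relation_mul_dot_pos hA hv hv0 i (ht₀ i)
    rcases lt_trichotomy (v ⬝ᵥ t₀) 0 with h0 | h0 | h0
    · exact ⟨-v, by rw [Matrix.neg_vecMul, hv, neg_zero],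
        fun i => neg_pos.2 (neg_of_mul_pos_left (h i) h0.le)⟩
    · simp [h0] at h
    · exact ⟨v, hv, fun i => pos_of_mul_pos_left (h i) h0.le⟩
  obtain ⟨S, hSv, hS⟩ := exists_slackLattice hA hv hv0
  have hN : ((S.D.toNat : ℕ) : ℤ) = S.D := Int.toNat_of_nonneg S.D_pos.le
  refine ⟨S.D.toNat, by have := S.D_pos; omega, S.countPoly 1, S.countPoly 0, ?_, ?_⟩
  · intro t ht
    have hpos : 0 < S.lam ⬝ᵥ t := by
      rw [hSv]
      exact pos_of_mul_pos_right
        (relation_mul_dot_pos hA hv (fun i => (hv0 i).ne') 0 (ht 0)) (hv0 0).le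
    have hsum : 0 < ∑ i, S.lam i := Finset.sum_pos (fun i _ => S.lam_pos i) Finset.univ_nonempty
    simp only [hN, S.eval_countPoly]
    constructor
    · rw [← ncard_mulVec_le_eq_count hA S hS (by rw [dotProduct_sub, dotProduct_one]; linarith),
        ← Nat.card_coe_set_eq]
      congr 3
      ext x
      rcases eq_or_ne n 0 with rfl | hn
      · have h0 : ∀ i, 0 < t i := fun i => by
          rw [Fin.fin_one_eq_zero i]
          have : 0 < S.lam 0 * t 0 := by
            rwa [dotProduct, Fin.sum_univ_succ, Fin.sum_univ_zero, add_zero] at hpos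
          exact pos_of_mul_pos_right this (S.lam_pos 0).le
        have huniv : {x : Fin 0 → ℝ | ∀ r, (A.map (Int.cast : ℤ → ℝ) *ᵥ x) r ≤ (t r : ℝ)}
            = Set.univ := Set.eq_univ_of_forall fun x r => by
          simpa [Matrix.mulVec, dotProduct] using (h0 r).le
        rw [huniv]
        simp only [interior_univ, Set.mem_univ, Set.mem_ofPred_eq, true_iff]
        intro i
        have := h0 i
        simp [Matrix.mulVec, dotProduct]
        omega
      · rw [interior_mulVec_le hA _ hn]
        simp only [Set.mem_ofPred_eq, map_mulVec_intCast, Int.cast_lt, Pi.sub_apply, Pi.one_apply,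
          Int.le_sub_one_iff]
    · rw [sub_zero, ← ncard_mulVec_le_eq_count hA S hS (by linarith), ← Nat.card_coe_set_eq]
      congr 3
      ext x
      simp only [Set.mem_ofPred_eq, map_mulVec_intCast, Int.cast_le]
  · intro t
    simp only [hN, S.eval_countPoly, sub_zero, S.count_reflect]
end
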